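/- arXiv:2406.07805 — 6 statements merged into one kernel-verified Lean document; each statement's English description precedes it below -/
import Mathlib

section
/- In the vertex-cover construction, let S ⊆ V_H be a vertex cover of H (every edge of H has at least one endpoint in S), and set resistances α_u = 1 for u ∈ S and α_u = 0 for u ∈ V_H ∖ S. Then the vector x ∈ ℝ^V defined by x_u = 1 for u ∈ S, x_u = d/(d+1) for u ∈ V_H ∖ S, and x_u = 0 for u ∈ {ũ} ∪ B is an equilibrium of the FJ dynamics, i.e. T(x) = x. -/
/-- In the vertex-cover construction (a `d`-regular graph `H` on vertex
set `VH`, an absorbing vertex `ũ = Sum.inr none`, and padding vertices `B`), if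
`S ⊆ VH` is a vertex cover of `H` and the resistances are `α = 1` on `S`, `α = 0` on
`VH \ S`, and `α = 1` on `{ũ} ∪ B`, then the vector `x` with `x = 1` on `S`,
`x = d/(d+1)` on `VH \ S` and `x = 0` on `{ũ} ∪ B` is an equilibrium of the FJ
dynamics, i.e. `T x = x`. -/
theorem stmt_3 {VH B : Type*} [Fintype VH] [Fintype B] [DecidableEq VH]
    (H : SimpleGraph VH) [DecidableRel H.Adj] (d : ℕ) (hd : 1 ≤ d)
    (hreg : H.IsRegularOfDegree d)
    (W : VH ⊕ Option B → VH ⊕ Option B → ℝ)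
    (hW_nonneg : ∀ u v, 0 ≤ W u v)
    (hW_stoch : ∀ v, ∑ u, W u v = 1)
    (hW_tilde : ∀ v : VH, W (Sum.inr none) (Sum.inl v) = 1 / ((d : ℝ) + 1))
    (hW_H : ∀ u v : VH,
      W (Sum.inl u) (Sum.inl v) = if H.Adj u v then 1 / ((d : ℝ) + 1) else 0)
    (hW_B : ∀ (b : B) (v : VH), W (Sum.inr (some b)) (Sum.inl v) = 0)
    (s : VH ⊕ Option B → ℝ)
    (hs_H : ∀ v : VH, s (Sum.inl v) = 1)
    (hs_o : ∀ o : Option B, s (Sum.inr o) = 0)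
    (α : VH ⊕ Option B → ℝ)
    (hα_o : ∀ o : Option B, α (Sum.inr o) = 1)
    (S : Finset VH)
    (hS_cover : ∀ u v : VH, H.Adj u v → u ∈ S ∨ v ∈ S)
    (hα_S : ∀ v : VH, v ∈ S → α (Sum.inl v) = 1)
    (hα_nS : ∀ v : VH, v ∉ S → α (Sum.inl v) = 0)
    (x : VH ⊕ Option B → ℝ)
    (hx_H : ∀ v : VH, x (Sum.inl v) = if v ∈ S then 1 else (d : ℝ) / ((d : ℝ) + 1))
    (hx_o : ∀ o : Option B, x (Sum.inr o) = 0) :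
    ∀ v, α v * s v + (1 - α v) * ∑ u, W u v * x u = x v := by
  rintro (v | o)
  · by_cases hv : v ∈ S
    · simp [hα_S v hv, hs_H, hx_H, hv]
    · have h1 : ∀ u : VH, W (Sum.inl u) (Sum.inl v) * x (Sum.inl u)
          = W (Sum.inl u) (Sum.inl v) := by
        intro u
        rw [hW_H, hx_H]
        by_cases h : H.Adj u v
        · have hu : u ∈ S := (hS_cover u v h).resolve_right hv
          simp [hu]
        · simp [h]
      have h2 := hW_stoch (Sum.inl v)
      simp only [Fintype.sum_sum_type, Fintype.sum_option, hW_tilde, hW_B,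
        Finset.sum_const_zero, add_zero] at h2
      have hd0 : (d : ℝ) + 1 ≠ 0 := by positivity
      rw [hα_nS v hv, hx_H, if_neg hv, Fintype.sum_sum_type]
      simp only [h1, hx_o, mul_zero, Finset.sum_const_zero, add_zero]
      have h3 : (d : ℝ) / (d + 1) = 1 - 1 / (d + 1) := by field_simp; ring
      rw [h3]
      linarith
  · simp [hα_o, hs_o, hx_o]
end

section
/- In the vertex-cover construction, let S ⊆ V_H be any subset, set α_u ∈ [0,1] arbitrarily for u ∈ S and α_u = 0 for u ∈ V_H ∖ S, and suppose S is not a vertex cover of H, so there is an edge {v, w} ∈ E_H with v ∉ S and w ∉ S. Then every equilibrium x of the FJ dynamics satisfies x_ũ = 0 and x_u = 0 for all u ∈ B; and if moreover x_u ≤ 1 for all u ∈ V_H, then x_w ≤ d/(d+1) and x_v ≤ d/(d+1) − 1/(d+1)². -/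
/-- In the vertex-cover construction, let `S ⊆ VH` be any subset, with
resistances arbitrary in `[0,1]` on `S`, equal to `0` on `VH \ S`, and equal to `1` on
`{ũ} ∪ B`. If `S` is not a vertex cover, witnessed by an edge `{v, w}` of `H` with
`v ∉ S` and `w ∉ S`, then every equilibrium `x` of the FJ dynamics satisfies
`x ũ = 0` and `x u = 0` for all `u ∈ B`; and if moreover `x ≤ 1` on `VH`, then
`x w ≤ d/(d+1)` and `x v ≤ d/(d+1) - 1/(d+1)²`. -/
theorem stmt_5 {VH B : Type*} [Fintype VH] [Fintype B] [DecidableEq VH]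
    (H : SimpleGraph VH) [DecidableRel H.Adj] (d : ℕ) (hd : 1 ≤ d)
    (hreg : H.IsRegularOfDegree d)
    (W : VH ⊕ Option B → VH ⊕ Option B → ℝ)
    (hW_nonneg : ∀ u v, 0 ≤ W u v)
    (hW_stoch : ∀ v, ∑ u, W u v = 1)
    (hW_tilde : ∀ v : VH, W (Sum.inr none) (Sum.inl v) = 1 / ((d : ℝ) + 1))
    (hW_H : ∀ u v : VH,
      W (Sum.inl u) (Sum.inl v) = if H.Adj u v then 1 / ((d : ℝ) + 1) else 0)
    (hW_B : ∀ (b : B) (v : VH), W (Sum.inr (some b)) (Sum.inl v) = 0)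
    (s : VH ⊕ Option B → ℝ)
    (hs_H : ∀ u : VH, s (Sum.inl u) = 1)
    (hs_o : ∀ o : Option B, s (Sum.inr o) = 0)
    (α : VH ⊕ Option B → ℝ)
    (hα_range : ∀ u, 0 ≤ α u ∧ α u ≤ 1)
    (hα_o : ∀ o : Option B, α (Sum.inr o) = 1)
    (S : Finset VH)
    (hα_nS : ∀ u : VH, u ∉ S → α (Sum.inl u) = 0)
    (v w : VH) (hvw : H.Adj v w) (hv : v ∉ S) (hw : w ∉ S)
    (x : VH ⊕ Option B → ℝ)
    (heq : ∀ z, α z * s z + (1 - α z) * ∑ u, W u z * x u = x z) :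
    (∀ o : Option B, x (Sum.inr o) = 0) ∧
    ((∀ u : VH, x (Sum.inl u) ≤ 1) →
      x (Sum.inl w) ≤ (d : ℝ) / ((d : ℝ) + 1) ∧
      x (Sum.inl v) ≤ (d : ℝ) / ((d : ℝ) + 1) - 1 / ((d : ℝ) + 1) ^ 2) := by
  have h0 : ∀ o : Option B, x (Sum.inr o) = 0 := by
    intro o
    have h := heq (Sum.inr o)
    rw [hα_o, hs_o] at h
    linarith
  refine ⟨h0, fun hx => ?_⟩
  have hpos : (0 : ℝ) < (d : ℝ) + 1 := by positivity
  have key : ∀ z : VH, z ∉ S →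
      x (Sum.inl z) = (∑ u ∈ H.neighborFinset z, x (Sum.inl u)) / ((d : ℝ) + 1) := by
    intro z hz
    have h := heq (Sum.inl z)
    rw [hα_nS z hz, Fintype.sum_sum_type] at h
    simp only [h0, hW_H, mul_zero, Finset.sum_const_zero, add_zero, zero_mul, zero_add,
      sub_zero, one_mul, ite_mul] at h
    rw [← h, SimpleGraph.neighborFinset_eq_filter, Finset.sum_filter, Finset.sum_div]
    refine Finset.sum_congr rfl fun u _ => ?_
    by_cases hu : H.Adj u z
    · simp [hu, hu.symm]
      ring
    · have hu2 : ¬ H.Adj z u := fun h => hu h.symm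
      simp [hu, hu2]
  have card : ∀ z : VH, (H.neighborFinset z).card = d := fun z => by
    rw [SimpleGraph.card_neighborFinset_eq_degree]
    exact hreg z
  have hw1 : x (Sum.inl w) ≤ (d : ℝ) / ((d : ℝ) + 1) := by
    rw [key w hw]
    gcongr
    calc ∑ u ∈ H.neighborFinset w, x (Sum.inl u) ≤ ∑ u ∈ H.neighborFinset w, (1 : ℝ) :=
          Finset.sum_le_sum fun u _ => hx u
      _ = d := by simp [hreg w]
  refine ⟨hw1, ?_⟩
  have hmem : w ∈ H.neighborFinset v := by simpa using hvw
  have h1 : ∑ u ∈ (H.neighborFinset v).erase w, x (Sum.inl u) ≤ (d : ℝ) - 1 := by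
    calc ∑ u ∈ (H.neighborFinset v).erase w, x (Sum.inl u)
          ≤ ∑ u ∈ (H.neighborFinset v).erase w, (1 : ℝ) :=
          Finset.sum_le_sum fun u _ => hx u
      _ = (d : ℝ) - 1 := by
        rw [Finset.sum_const, Finset.card_erase_of_mem hmem, card v, nsmul_eq_mul,
          Nat.cast_sub hd]
        simp
  rw [key v hv, ← Finset.add_sum_erase _ _ hmem]
  calc _ ≤ ((d : ℝ) / ((d : ℝ) + 1) + ((d : ℝ) - 1)) / ((d : ℝ) + 1) := by gcongr
    _ = _ := by
      field_simp
      ring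
end

section
/- For all integers d ≥ 1, n ≥ 1 and 0 ≤ k ≤ n, setting q = d/(d+1) and c = 1/(d+1)², there exists L such that for every integer ℓ ≥ L, with N = n + ℓ + 1 and ε = (k + (n−k)q)/N, the strict inequality (1/N)·(k + (n−k−1)q² + (q − c)²) + ε² < (1/N)·(k + (n−k)q² − 3nε) holds. (This is the separation between the upper bound on the polarization achievable without a vertex cover and the threshold τ achieved with a vertex cover in the NP-hardness reduction.) -/
/-- For all integers `d ≥ 1`, `n ≥ 1` and `0 ≤ k ≤ n`, with
`q = d/(d+1)` and `c = 1/(d+1)²`, there exists `L` such that for every `ℓ ≥ L`,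
setting `N = n + ℓ + 1` and `ε = (k + (n-k)q)/N`, the strict inequality
`(1/N)(k + (n-k-1)q² + (q-c)²) + ε² < (1/N)(k + (n-k)q² - 3nε)` holds. -/
theorem stmt_7 (d n k : ℕ) (hd : 1 ≤ d) (hn : 1 ≤ n) (hk : k ≤ n) :
    ∃ L : ℕ, ∀ ℓ : ℕ, L ≤ ℓ →
      (1 / ((n : ℝ) + ℓ + 1)) *
          ((k : ℝ) + ((n : ℝ) - k - 1) * ((d : ℝ) / ((d : ℝ) + 1)) ^ 2 +
            ((d : ℝ) / ((d : ℝ) + 1) - 1 / ((d : ℝ) + 1) ^ 2) ^ 2) +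
        (((k : ℝ) + ((n : ℝ) - k) * ((d : ℝ) / ((d : ℝ) + 1))) /
            ((n : ℝ) + ℓ + 1)) ^ 2 <
      (1 / ((n : ℝ) + ℓ + 1)) *
        ((k : ℝ) + ((n : ℝ) - k) * ((d : ℝ) / ((d : ℝ) + 1)) ^ 2 -
          3 * n *
            (((k : ℝ) + ((n : ℝ) - k) * ((d : ℝ) / ((d : ℝ) + 1))) /
              ((n : ℝ) + ℓ + 1))) := by
  have hd' : (1 : ℝ) ≤ d := by exact_mod_cast hd
  have hq : (1 : ℝ) / 2 ≤ (d : ℝ) / ((d : ℝ) + 1) := by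
    rw [div_le_div_iff₀ (by norm_num) (by linarith)]; linarith
  have hc0 : (0 : ℝ) < 1 / ((d : ℝ) + 1) ^ 2 := by positivity
  have hc1 : 1 / ((d : ℝ) + 1) ^ 2 < (1 : ℝ) := by
    rw [div_lt_one (by positivity)]; nlinarith
  generalize (d : ℝ) / ((d : ℝ) + 1) = q at *
  generalize 1 / ((d : ℝ) + 1) ^ 2 = c at *
  have hδ : 0 < c * (2 * q - c) := mul_pos hc0 (by linarith)
  generalize hS : (k : ℝ) + ((n : ℝ) - k) * q = S
  obtain ⟨L, hL⟩ := exists_nat_gt ((S ^ 2 + 3 * n * S) / (c * (2 * q - c)))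
  refine ⟨L, fun l hl => ?_⟩
  have hl' : (L : ℝ) ≤ l := by exact_mod_cast hl
  have hn0 : (0 : ℝ) ≤ n := Nat.cast_nonneg n
  have hN : (0 : ℝ) < (n : ℝ) + l + 1 := by positivity
  have hlN : (l : ℝ) ≤ (n : ℝ) + l + 1 := by linarith
  generalize (n : ℝ) + l + 1 = N at *
  rw [div_lt_iff₀ hδ] at hL
  have h1 : S ^ 2 + 3 * n * S < N * (c * (2 * q - c)) :=
    lt_of_lt_of_le hL (mul_le_mul_of_nonneg_right (by linarith) hδ.le)
  rw [← sub_pos]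
  have h2 : (1 / N) * ((k : ℝ) + ((n : ℝ) - k) * q ^ 2 - 3 * n * (S / N)) -
      ((1 / N) * ((k : ℝ) + ((n : ℝ) - k - 1) * q ^ 2 + (q - c) ^ 2) + (S / N) ^ 2) =
      (N * (c * (2 * q - c)) - (S ^ 2 + 3 * n * S)) / N ^ 2 := by
    field_simp
    ring
  rw [h2]
  exact div_pos (by linarith) (by positivity)
end

section
/- Fix β ∈ (0,1). For each integer ℓ ≥ 1, let x⋆(ℓ), x†(ℓ), x‡(ℓ) ∈ ℝ^{2ℓ+2} be the vectors defined on the two-community instance as follows: x⋆(ℓ) takes values (1−β)/(1+β) at v, −(1−β)/(1+β) at w, and 0 on A ∪ B; x†(ℓ) takes values 1 at v, 2β − 1 at w, β on B, and 0 on A; x‡(ℓ) takes values 1 at v, at w, and on B, and 0 on A. Then, as ℓ → ∞, Polarization(x†(ℓ)) − Polarization(x⋆(ℓ)) → β²/4 and Polarization(x‡(ℓ)) − Polarization(x†(ℓ)) → (1 − β²)/4. Consequently, for every β with 0 < β < 1/√2 there exists L such that for all ℓ ≥ L, Polarization(x‡(ℓ)) − Polarization(x†(ℓ)) > Polarization(x†(ℓ))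 − Polarization(x⋆(ℓ)); i.e., the second stooge yields a strictly larger marginal increase in polarization than the first, so polarization does not exhibit diminishing returns (is not submodular) as a function of the stooge set. -/
/-- Polarization of a vector `x : V → ℝ`: `(1/|V|) · ∑ (x_v - x̄)²` where `x̄` is the
mean of `x`. -/
noncomputable def polarization {V : Type*} [Fintype V] (x : V → ℝ) : ℝ :=
  (1 / (Fintype.card V : ℝ)) *
    ∑ v, (x v - (1 / (Fintype.card V : ℝ)) * ∑ u, x u) ^ 2

/-- The two-community instance on `2ℓ + 2` vertices: `A = Sum.inl (Sum.inl _)`,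
`B = Sum.inl (Sum.inr _)`, `v = Sum.inr true`, `w = Sum.inr false`.
Equilibrium with no stooges: `(1-β)/(1+β)` at `v`, `-(1-β)/(1+β)` at `w`, `0` on
`A ∪ B`. -/
noncomputable def xStar (β : ℝ) (ℓ : ℕ) : (Fin ℓ ⊕ Fin ℓ) ⊕ Bool → ℝ
  | Sum.inl _ => 0
  | Sum.inr true => (1 - β) / (1 + β)
  | Sum.inr false => -((1 - β) / (1 + β))

/-- Equilibrium of the two-community instance with `v` as stooge (`α_v = 1`): `1` at
`v`, `2β - 1` at `w`, `β` on `B`, `0` on `A`. -/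
noncomputable def xDagger (β : ℝ) (ℓ : ℕ) : (Fin ℓ ⊕ Fin ℓ) ⊕ Bool → ℝ
  | Sum.inl (Sum.inl _) => 0
  | Sum.inl (Sum.inr _) => β
  | Sum.inr true => 1
  | Sum.inr false => 2 * β - 1

/-- Equilibrium of the two-community instance with both `v` and `w` as stooges
(`α_v = 1`, `α_w = 0`): `1` at `v`, at `w` and on `B`, `0` on `A`. -/
noncomputable def xDDagger (_β : ℝ) (ℓ : ℕ) : (Fin ℓ ⊕ Fin ℓ) ⊕ Bool → ℝ
  | Sum.inl (Sum.inl _) => 0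
  | Sum.inl (Sum.inr _) => 1
  | Sum.inr _ => 1

theorem pol_formula (ℓ : ℕ) (b p q : ℝ) (x : (Fin ℓ ⊕ Fin ℓ) ⊕ Bool → ℝ)
    (hA : ∀ i, x (Sum.inl (Sum.inl i)) = 0) (hB : ∀ i, x (Sum.inl (Sum.inr i)) = b)
    (hv : x (Sum.inr true) = p) (hw : x (Sum.inr false) = q) :
    polarization x = (1 - 1 / ((ℓ : ℝ) + 1)) / 2 * b ^ 2
      + (1 / ((ℓ : ℝ) + 1)) / 2 * (p ^ 2 + q ^ 2)
      - ((1 - 1 / ((ℓ : ℝ) + 1)) / 2 * b + (1 / ((ℓ : ℝ) + 1)) / 2 * (p + q)) ^ 2 := by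
  have h : (ℓ : ℝ) + 1 ≠ 0 := by positivity
  have h2 : (ℓ : ℝ) + ℓ + 2 ≠ 0 := by positivity
  simp only [polarization, Fintype.sum_sum_type, Fintype.sum_bool, hA, hB, hv, hw,
    Finset.sum_const, Finset.card_univ, Fintype.card_fin, Fintype.card_sum, Fintype.card_bool,
    nsmul_eq_mul]
  push_cast
  have h3 : (ℓ : ℝ) + ℓ + 2 = 2 * (ℓ + 1) := by ring
  rw [h3]
  field_simp
  ring

theorem pol_tendsto (b p q : ℝ) (x : (ℓ : ℕ) → (Fin ℓ ⊕ Fin ℓ) ⊕ Bool → ℝ)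
    (hA : ∀ ℓ i, x ℓ (Sum.inl (Sum.inl i)) = 0) (hB : ∀ ℓ i, x ℓ (Sum.inl (Sum.inr i)) = b)
    (hv : ∀ ℓ, x ℓ (Sum.inr true) = p) (hw : ∀ ℓ, x ℓ (Sum.inr false) = q) :
    Filter.Tendsto (fun ℓ : ℕ => polarization (x ℓ)) Filter.atTop (nhds (b ^ 2 / 4)) := by
  have ht := tendsto_one_div_add_atTop_nhds_zero_nat (𝕜 := ℝ)
  have hc : Continuous (fun t : ℝ => (1 - t) / 2 * b ^ 2 + t / 2 * (p ^ 2 + q ^ 2)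
      - ((1 - t) / 2 * b + t / 2 * (p + q)) ^ 2) := by fun_prop
  have := (hc.tendsto 0).comp ht
  convert this using 2 with ℓ
  · exact pol_formula ℓ b p q (x ℓ) (hA ℓ) (hB ℓ) (hv ℓ) (hw ℓ)
  · ring

/-- Fix `β ∈ (0,1)`. As `ℓ → ∞`,
`Polarization(x†(ℓ)) - Polarization(x⋆(ℓ)) → β²/4` and
`Polarization(x‡(ℓ)) - Polarization(x†(ℓ)) → (1-β²)/4`. Consequently, for
`0 < β < 1/√2` there exists `L` such that for all `ℓ ≥ L` the second stooge yields a
strictly larger marginal increase in polarization than the first: polarization is not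
submodular in the stooge set. -/
theorem stmt_11 (β : ℝ) (hβ0 : 0 < β) (hβ1 : β < 1) :
    Filter.Tendsto (fun ℓ : ℕ => polarization (xDagger β ℓ) - polarization (xStar β ℓ))
      Filter.atTop (nhds (β ^ 2 / 4)) ∧
    Filter.Tendsto
      (fun ℓ : ℕ => polarization (xDDagger β ℓ) - polarization (xDagger β ℓ))
      Filter.atTop (nhds ((1 - β ^ 2) / 4)) ∧
    (β < 1 / Real.sqrt 2 → ∃ L : ℕ, ∀ ℓ : ℕ, L ≤ ℓ →
      polarization (xDDagger β ℓ) - polarization (xDagger β ℓ) >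
        polarization (xDagger β ℓ) - polarization (xStar β ℓ)) := by
  have h0 := pol_tendsto 0 ((1 - β) / (1 + β)) (-((1 - β) / (1 + β))) (xStar β)
    (fun _ _ => rfl) (fun _ _ => rfl) (fun _ => rfl) (fun _ => rfl)
  have h1 := pol_tendsto β 1 (2 * β - 1) (xDagger β)
    (fun _ _ => rfl) (fun _ _ => rfl) (fun _ => rfl) (fun _ => rfl)
  have h2 := pol_tendsto 1 1 1 (xDDagger β)
    (fun _ _ => rfl) (fun _ _ => rfl) (fun _ => rfl) (fun _ => rfl)
  have h10 := h1.sub h0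
  have h21 := h2.sub h1
  rw [show β ^ 2 / 4 - 0 ^ 2 / 4 = β ^ 2 / 4 by ring] at h10
  rw [show 1 ^ 2 / 4 - β ^ 2 / 4 = (1 - β ^ 2) / 4 by ring] at h21
  refine ⟨h10, h21, fun hb => ?_⟩
  have hsq : β ^ 2 < 1 / 2 := by
    have := pow_lt_pow_left₀ hb hβ0.le (n := 2) (by norm_num)
    rwa [div_pow, Real.sq_sqrt (by norm_num), one_pow] at this
  have hlt : β ^ 2 / 4 < (1 - β ^ 2) / 4 := by linarith
  exact Filter.eventually_atTop.mp (h10.eventually_lt h21 hlt)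
end

section
/- (a) In the baseline lollipop instance, the all-zeros vector is an equilibrium of the FJ dynamics, and its MSE equals (2/(n+m))², where θ̂ = 2/(n+m) is the mean innate opinion. (b) In the one-stooge lollipop instance obtained by changing α_{p_1} to 1, every equilibrium x satisfies x_{p_i} = 1 for all 1 ≤ i ≤ m; consequently MSE(x) ≥ (m/(n+m))·(1 − 2/(n+m))², and if m·(n+m−2)² > 4·(n+m), then MSE(x) > (2/(n+m))², i.e. designating p_1 as a stooge strictly increases the MSE. -/
/-- Lollipop instance: vertex set `K ⊕ Fin m` with `|K| = n ≥ 1` and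
path vertices `p_1, …, p_m` given by `Sum.inr 0, …, Sum.inr (m-1)`, `m ≥ 2`. Innate
opinions are `0` on `K`, `1` at `p_1` and at a designated path vertex `p_j` (`j ≠ p_1`),
and `0` elsewhere; resistances on `K` lie in `(0,1]` and are `0` on the path.
(a) In the baseline instance the all-zeros vector is an equilibrium and its MSE equals
`(2/(n+m))²` (where `θ̂ = 2/(n+m)` is the mean innate opinion).
(b) In the one-stooge instance obtained by changing `α_{p_1}` to `1`, every equilibrium
`x` satisfies `x_{p_i} = 1` for all `i`; consequently
`MSE(x) ≥ (m/(n+m))·(1 - 2/(n+m))²`, and if `m·(n+m-2)² > 4·(n+m)` then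
`MSE(x) > (2/(n+m))²`, i.e. designating `p_1` a stooge strictly increases the MSE. -/
theorem stmt_12 {K : Type*} [Fintype K] (n m : ℕ) (hn : 1 ≤ n) (hm : 2 ≤ m)
    (hK : Fintype.card K = n)
    (W : K ⊕ Fin m → K ⊕ Fin m → ℝ)
    (hW_nonneg : ∀ u v, 0 ≤ W u v)
    (hW_stoch : ∀ v, ∑ u, W u v = 1)
    (hW_mid : ∀ (i : Fin m) (_h1 : 0 < (i : ℕ)) (_h2 : (i : ℕ) < m - 1),
      W (Sum.inr ⟨(i : ℕ) - 1, by omega⟩) (Sum.inr i) = 1 / 2 ∧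
      W (Sum.inr ⟨(i : ℕ) + 1, by omega⟩) (Sum.inr i) = 1 / 2 ∧
      ∀ u, u ≠ Sum.inr ⟨(i : ℕ) - 1, by omega⟩ → u ≠ Sum.inr ⟨(i : ℕ) + 1, by omega⟩ →
        W u (Sum.inr i) = 0)
    (hW_last : W (Sum.inr ⟨m - 2, by omega⟩) (Sum.inr ⟨m - 1, by omega⟩) = 1 ∧
      ∀ u, u ≠ Sum.inr ⟨m - 2, by omega⟩ → W u (Sum.inr ⟨m - 1, by omega⟩) = 0)
    (j : Fin m) (hj : 0 < (j : ℕ))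
    (s : K ⊕ Fin m → ℝ)
    (hsK : ∀ u : K, s (Sum.inl u) = 0)
    (hs0 : s (Sum.inr ⟨0, by omega⟩) = 1)
    (hsj : s (Sum.inr j) = 1)
    (hs_other : ∀ i : Fin m, (i : ℕ) ≠ 0 → i ≠ j → s (Sum.inr i) = 0)
    (α : K ⊕ Fin m → ℝ)
    (hαK : ∀ u : K, 0 < α (Sum.inl u) ∧ α (Sum.inl u) ≤ 1)
    (hαP : ∀ i : Fin m, α (Sum.inr i) = 0)
    (α' : K ⊕ Fin m → ℝ)
    (hα'0 : α' (Sum.inr ⟨0, by omega⟩) = 1)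
    (hα' : ∀ v, v ≠ Sum.inr (⟨0, by omega⟩ : Fin m) → α' v = α v) :
    ((∀ v, α v * s v + (1 - α v) * ∑ u, W u v * (0 : ℝ) = (0 : ℝ)) ∧
      (1 / ((n : ℝ) + m)) * ∑ _v : K ⊕ Fin m, ((0 : ℝ) - 2 / ((n : ℝ) + m)) ^ 2 =
        (2 / ((n : ℝ) + m)) ^ 2) ∧
    (∀ x : K ⊕ Fin m → ℝ,
      (∀ v, α' v * s v + (1 - α' v) * ∑ u, W u v * x u = x v) →
      (∀ i : Fin m, x (Sum.inr i) = 1) ∧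
      (1 / ((n : ℝ) + m)) * ∑ v, (x v - 2 / ((n : ℝ) + m)) ^ 2 ≥
        ((m : ℝ) / ((n : ℝ) + m)) * (1 - 2 / ((n : ℝ) + m)) ^ 2 ∧
      ((m : ℝ) * ((n : ℝ) + m - 2) ^ 2 > 4 * ((n : ℝ) + m) →
        (1 / ((n : ℝ) + m)) * ∑ v, (x v - 2 / ((n : ℝ) + m)) ^ 2 >
          (2 / ((n : ℝ) + m)) ^ 2)) := by
  classical
  have hN : (0 : ℝ) < (n : ℝ) + m := by
    have : (1 : ℝ) ≤ n := by exact_mod_cast hn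
    positivity
  refine ⟨⟨?_, ?_⟩, ?_⟩
  · rintro (u | i)
    · simp [hsK]
    · simp [hαP]
  · rw [Finset.sum_const, Finset.card_univ, Fintype.card_sum, hK, Fintype.card_fin, nsmul_eq_mul]
    push_cast
    field_simp
    ring
  intro x hx
  have hx0 : x (Sum.inr ⟨0, by omega⟩) = 1 := by
    rw [← hx, hα'0, hs0]; ring
  have hxp : ∀ i : Fin m, 0 < (i : ℕ) → x (Sum.inr i) = ∑ u, W u (Sum.inr i) * x u := by
    intro i hi
    have hne : (Sum.inr i : K ⊕ Fin m) ≠ Sum.inr (⟨0, by omega⟩ : Fin m) := by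
      intro h
      have h2 := Sum.inr.inj h
      rw [h2] at hi
      simp at hi
    have h := hx (Sum.inr i)
    rw [hα' _ hne, hαP] at h
    linarith
  have hmid : ∀ k (h0 : 0 < k) (h1 : k + 1 < m), 2 * x (Sum.inr ⟨k, by omega⟩) =
      x (Sum.inr ⟨k - 1, by omega⟩) + x (Sum.inr ⟨k + 1, h1⟩) := by
    intro k h0 h1
    obtain ⟨ha, hb, hc⟩ := hW_mid ⟨k, by omega⟩ h0 (by simp only; omega)
    have h := hxp ⟨k, by omega⟩ h0
    have hk1 : k - 1 < m := by omega
    have hne : (Sum.inr ⟨k - 1, hk1⟩ : K ⊕ Fin m) ≠ Sum.inr ⟨k + 1, h1⟩ := by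
      simp only [ne_eq, Sum.inr.injEq, Fin.mk.injEq]
      omega
    have hz : ∀ c ∈ (Finset.univ : Finset (K ⊕ Fin m)),
        c ≠ Sum.inr ⟨k - 1, hk1⟩ ∧ c ≠ Sum.inr ⟨k + 1, h1⟩ →
        W c (Sum.inr ⟨k, by omega⟩) * x c = 0 := by
      intro c _ hcc
      rw [hc c hcc.1 hcc.2, zero_mul]
    rw [Finset.sum_eq_add _ _ hne hz (by simp) (by simp)] at h
    simp only at ha hb
    rw [ha, hb] at h
    linarith
  have hlast : x (Sum.inr ⟨m - 1, by omega⟩) = x (Sum.inr ⟨m - 2, by omega⟩) := by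
    have h := hxp ⟨m - 1, by omega⟩ (by simp only; omega)
    rw [Finset.sum_eq_single (Sum.inr ⟨m - 2, by omega⟩)
      (by intro c _ hcc; rw [hW_last.2 c hcc, zero_mul]) (by simp), hW_last.1] at h
    linarith
  have hstep : ∀ d k (h : k + 1 < m), k + 2 + d = m →
      x (Sum.inr ⟨k + 1, h⟩) = x (Sum.inr ⟨k, by omega⟩) := by
    intro d
    induction d with
    | zero =>
      intro k h hk
      subst hk
      exact hlast
    | succ d ih =>
      intro k h hk
      have h1 := ih (k + 1) (by omega) (by omega)
      have h2 := hmid (k + 1) (by omega) (by omega)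
      simp only [Nat.add_sub_cancel] at h2
      linarith
  have hall : ∀ k (h : k < m), x (Sum.inr ⟨k, h⟩) = 1 := by
    intro k
    induction k with
    | zero => intro h; exact hx0
    | succ k ih =>
      intro h
      rw [hstep (m - (k + 2)) k h (by omega)]
      exact ih _
  have hall' : ∀ i : Fin m, x (Sum.inr i) = 1 := fun i => hall i.1 i.2
  have hge : (1 / ((n : ℝ) + m)) * ∑ v, (x v - 2 / ((n : ℝ) + m)) ^ 2 ≥
        ((m : ℝ) / ((n : ℝ) + m)) * (1 - 2 / ((n : ℝ) + m)) ^ 2 := by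
    rw [Fintype.sum_sum_type]
    simp only [hall', Finset.sum_const, Finset.card_univ, Fintype.card_fin, nsmul_eq_mul]
    have h0 : 0 ≤ ∑ u : K, (x (Sum.inl u) - 2 / ((n : ℝ) + m)) ^ 2 :=
      Finset.sum_nonneg fun _ _ => sq_nonneg _
    have h1 : 0 ≤ 1 / ((n : ℝ) + m) * ∑ u : K, (x (Sum.inl u) - 2 / ((n : ℝ) + m)) ^ 2 := by
      positivity
    rw [mul_add, ge_iff_le, div_eq_mul_one_div (m : ℝ)]
    linarith
  refine ⟨hall', hge, fun h => lt_of_lt_of_le ?_ hge⟩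
  have e : ((m : ℝ) / ((n : ℝ) + m)) * (1 - 2 / ((n : ℝ) + m)) ^ 2 =
      (m * ((n : ℝ) + m - 2) ^ 2) / ((n : ℝ) + m) ^ 3 := by
    field_simp
  have e2 : (2 / ((n : ℝ) + m)) ^ 2 = (4 * ((n : ℝ) + m)) / ((n : ℝ) + m) ^ 3 := by
    field_simp
    norm_num
  rw [e, e2]
  exact div_lt_div_of_pos_right h (by positivity)
end

section
/- Consider the one-stooge lollipop instance where α_{p_1} is changed to 1, and the two-stooge lollipop instance where additionally α_{p_j} is changed to 1 (note s_{p_j} = 1 already). A vector x ∈ ℝ^V is an equilibrium of the one-stooge instance if and only if it is an equilibrium of the two-stooge instance. In particular the two instances have identical sets of equilibria, hence identical MSE and polarization at equilibrium: designating p_j as an additional stooge yields zero marginal change, which together with the strict increase produced by the first stooge p_1 shows that the MSE is not supermodular as a function of the stooge set. -/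
theorem lolli_down (f : ℕ → ℝ) (M k : ℕ)
    (hmid : ∀ i, k < i → i < M → f i = (f (i-1) + f (i+1)) / 2)
    (hlast : k < M → f M = f (M-1)) : ∀ i, k ≤ i → i ≤ M → f i = f k := by
  have key : ∀ t i, k ≤ i → i + 1 + t = M → f (i+1) = f i := by
    intro t
    induction t with
    | zero =>
      intro i hi h
      have := hlast (by omega)
      have e : M = i + 1 := by omega
      subst e
      simpa using this
    | succ t ih =>
      intro i hi h
      have h1 := ih (i+1) (by omega) (by omega)
      have h2 := hmid (i+1) (by omega) (by omega)
      simp only [Nat.add_sub_cancel] at h2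
      linarith
  intro i hi
  induction i, hi using Nat.le_induction with
  | base => intro _; rfl
  | succ i hi ih =>
    intro h
    rw [key (M - (i+1)) i hi (by omega)]
    exact ih (by omega)

theorem lolli_seg (f : ℕ → ℝ) (j : ℕ) (hj : 0 < j)
    (hmid : ∀ i, 0 < i → i < j → f i = (f (i-1) + f (i+1)) / 2)
    (h0 : f 0 = 1) (h1 : f j = 1) : f (j-1) = 1 := by
  have key : ∀ i, i + 1 ≤ j → f i = 1 + i * (f 1 - 1) ∧ f (i+1) = 1 + (i+1) * (f 1 - 1) := by
    intro i
    induction i with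
    | zero => intro _; simp [h0]
    | succ i ih =>
      intro h
      obtain ⟨a, b⟩ := ih (by omega)
      have h2 := hmid (i+1) (by omega) (by omega)
      simp only [Nat.add_sub_cancel] at h2
      push_cast
      exact ⟨b, by linarith⟩
  obtain ⟨i, rfl⟩ : ∃ i, j = i + 1 := ⟨j - 1, by omega⟩
  obtain ⟨a, b⟩ := key i le_rfl
  rw [h1] at b
  have hp : (i : ℝ) + 1 ≠ 0 := by positivity
  have : f 1 - 1 = 0 := by
    have : ((i : ℝ) + 1) * (f 1 - 1) = 0 := by linarith
    exact (mul_eq_zero.mp this).resolve_left hp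
  simp [a, this]

/-- Lollipop instance as in Statement 12. Consider the one-stooge
instance where `α_{p_1}` is changed to `1` (resistances `α'`), and the two-stooge
instance where additionally `α_{p_j}` is changed to `1` (resistances `α''`; note
`s_{p_j} = 1` already). Then a vector `x` is an equilibrium of the one-stooge instance
if and only if it is an equilibrium of the two-stooge instance; in particular the two
instances have identical sets of equilibria, hence identical MSE and polarization at
equilibrium, so the MSE is not supermodular in the stooge set. -/
theorem stmt_13 {K : Type*} [Fintype K] (n m : ℕ) (hn : 1 ≤ n) (hm : 2 ≤ m)
    (hK : Fintype.card K = n)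
    (W : K ⊕ Fin m → K ⊕ Fin m → ℝ)
    (hW_nonneg : ∀ u v, 0 ≤ W u v)
    (hW_stoch : ∀ v, ∑ u, W u v = 1)
    (hW_mid : ∀ (i : Fin m) (_h1 : 0 < (i : ℕ)) (_h2 : (i : ℕ) < m - 1),
      W (Sum.inr ⟨(i : ℕ) - 1, by omega⟩) (Sum.inr i) = 1 / 2 ∧
      W (Sum.inr ⟨(i : ℕ) + 1, by omega⟩) (Sum.inr i) = 1 / 2 ∧
      ∀ u, u ≠ Sum.inr ⟨(i : ℕ) - 1, by omega⟩ → u ≠ Sum.inr ⟨(i : ℕ) + 1, by omega⟩ →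
        W u (Sum.inr i) = 0)
    (hW_last : W (Sum.inr ⟨m - 2, by omega⟩) (Sum.inr ⟨m - 1, by omega⟩) = 1 ∧
      ∀ u, u ≠ Sum.inr ⟨m - 2, by omega⟩ → W u (Sum.inr ⟨m - 1, by omega⟩) = 0)
    (j : Fin m) (hj : 0 < (j : ℕ))
    (s : K ⊕ Fin m → ℝ)
    (hsK : ∀ u : K, s (Sum.inl u) = 0)
    (hs0 : s (Sum.inr ⟨0, by omega⟩) = 1)
    (hsj : s (Sum.inr j) = 1)
    (hs_other : ∀ i : Fin m, (i : ℕ) ≠ 0 → i ≠ j → s (Sum.inr i) = 0)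
    (α : K ⊕ Fin m → ℝ)
    (hαK : ∀ u : K, 0 < α (Sum.inl u) ∧ α (Sum.inl u) ≤ 1)
    (hαP : ∀ i : Fin m, α (Sum.inr i) = 0)
    (α' : K ⊕ Fin m → ℝ)
    (hα'0 : α' (Sum.inr ⟨0, by omega⟩) = 1)
    (hα' : ∀ v, v ≠ Sum.inr (⟨0, by omega⟩ : Fin m) → α' v = α v)
    (α'' : K ⊕ Fin m → ℝ)
    (hα''j : α'' (Sum.inr j) = 1)
    (hα'' : ∀ v, v ≠ Sum.inr j → α'' v = α' v) :
    ∀ x : K ⊕ Fin m → ℝ,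
      (∀ v, α' v * s v + (1 - α' v) * ∑ u, W u v * x u = x v) ↔
      (∀ v, α'' v * s v + (1 - α'' v) * ∑ u, W u v * x u = x v) := by
  classical
  intro x
  obtain ⟨f, hf⟩ : ∃ f : ℕ → ℝ, ∀ i : Fin m, x (Sum.inr i) = f i :=
    ⟨fun i => if h : i < m then x (Sum.inr ⟨i, h⟩) else 0, fun i => by simp⟩
  have Smid : ∀ i : Fin m, 0 < (i : ℕ) → (i : ℕ) < m - 1 →
      ∑ u, W u (Sum.inr i) * x u = (f (i - 1) + f (i + 1)) / 2 := by
    intro i h1 h2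
    obtain ⟨a, b, c⟩ := hW_mid i h1 h2
    have p1 : (i : ℕ) - 1 < m := by omega
    have p2 : (i : ℕ) + 1 < m := by omega
    have hne : (Sum.inr ⟨(i : ℕ) - 1, p1⟩ : K ⊕ Fin m) ≠ Sum.inr ⟨(i : ℕ) + 1, p2⟩ := by
      intro h
      have := congrArg Fin.val (Sum.inr.inj h)
      simp only at this
      omega
    rw [Fintype.sum_eq_add (Sum.inr ⟨(i : ℕ) - 1, p1⟩) (Sum.inr ⟨(i : ℕ) + 1, p2⟩)
      hne (fun u hu => by rw [c u hu.1 hu.2, zero_mul]), a, b, hf, hf]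
    simp only
    ring
  have Slast : ∀ i : Fin m, (i : ℕ) = m - 1 →
      ∑ u, W u (Sum.inr i) * x u = f (i - 1) := by
    intro i hi
    have p1 : m - 1 < m := by omega
    have p2 : m - 2 < m := by omega
    have hi2 : i = ⟨m - 1, p1⟩ := Fin.ext hi
    clear hi
    subst hi2
    obtain ⟨a, c⟩ := hW_last
    rw [Fintype.sum_eq_single (Sum.inr ⟨m - 2, p2⟩)
      (fun u hu => by rw [c u hu, zero_mul]), a, hf]
    simp only [one_mul]
    rfl
  have A' : ∀ i : Fin m, 0 < (i : ℕ) → α' (Sum.inr i) = 0 := by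
    intro i hi
    rw [hα' _ (by intro h; have := Sum.inr.inj h; rw [this] at hi; simp at hi), hαP]
  have hj0 : (Sum.inr ⟨0, by omega⟩ : K ⊕ Fin m) ≠ Sum.inr j := by
    intro h; have := Sum.inr.inj h; rw [← this] at hj; simp at hj
  have hjm := j.isLt
  have hfj := hf j
  constructor
  · intro H
    have P : ∀ i : Fin m, 0 < (i : ℕ) → ∑ u, W u (Sum.inr i) * x u = f i := by
      intro i hi
      have := H (Sum.inr i)
      rw [A' i hi, hf] at this
      linarith
    have f0 : f 0 = 1 := by
      have := H (Sum.inr ⟨0, by omega⟩)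
      rw [hα'0, hs0, hf] at this
      simp only at this
      linarith
    have hall := lolli_down f (m-1) 0
      (fun i h1 h2 => by
        have := P ⟨i, by omega⟩ h1
        rw [Smid ⟨i, by omega⟩ h1 h2] at this
        exact this.symm)
      (fun h => by
        have := P ⟨m-1, by omega⟩ h
        rw [Slast ⟨m-1, by omega⟩ rfl] at this
        exact this.symm)
    intro v
    by_cases hv : v = Sum.inr j
    · subst hv
      rw [hα''j, hsj, hfj, hall j (by omega) (by omega), f0]
      ring
    · rw [hα'' v hv]; exact H v
  · intro H
    have P : ∀ i : Fin m, 0 < (i : ℕ) → (i : ℕ) ≠ j →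
        ∑ u, W u (Sum.inr i) * x u = f i := by
      intro i hi hij
      have := H (Sum.inr i)
      rw [hα'' _ (by intro h; exact hij (by rw [Sum.inr.inj h])), A' i hi, hf] at this
      linarith
    have f0 : f 0 = 1 := by
      have := H (Sum.inr ⟨0, by omega⟩)
      rw [hα'' _ hj0, hα'0, hs0, hf] at this
      simp only at this
      linarith
    have fj : f j = 1 := by
      have := H (Sum.inr j)
      rw [hα''j, hsj, hf] at this
      linarith
    have hseg := lolli_seg f j hj
      (fun i h1 h2 => by
        have := P ⟨i, by omega⟩ h1 (by simp only; omega)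
        rw [Smid ⟨i, by omega⟩ h1 (by simp only; omega)] at this
        exact this.symm) f0 fj
    have hall := lolli_down f (m-1) j
      (fun i h1 h2 => by
        have := P ⟨i, by omega⟩ (by simp only; omega) (by simp only; omega)
        rw [Smid ⟨i, by omega⟩ (by simp only; omega) h2] at this
        exact this.symm)
      (fun h => by
        have := P ⟨m-1, by omega⟩ (by simp only; omega) (by simp only; omega)
        rw [Slast ⟨m-1, by omega⟩ rfl] at this
        exact this.symm)
    intro v
    by_cases hv : v = Sum.inr j
    · subst hv
      have hS : ∑ u, W u (Sum.inr j) * x u = 1 := by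
        by_cases h : (j : ℕ) = m - 1
        · rw [Slast j h, hseg]
        · rw [Smid j hj (by omega), hseg, hall (j+1) (by omega) (by omega), fj]
          norm_num
      rw [A' j hj, hS, hfj, fj]
      ring
    · rw [← hα'' v hv]; exact H v
end
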